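/- Let ω ∈ (π/2, π), set q_ω = (√2/π)(π − ω), and let 0 < q < q_ω. Let (a,f,g) ∈ 𝒞 satisfy 0 ≤ f(r) ≤ π/2 for all r, and suppose E₂(a,g) ≤ E₂(a,G) for every function G locally absolutely continuous on (0,∞) with lim_{r→∞} G(r) = q. Set C₁ = 1/2 − q²/(π − ω)² and C₂ = 2(q_ω² − q²)/(π − ω)². Then C₁ > 0, C₂ > 0, and L(a,f,g) ≥ ∫₀^∞ { 2(2 a'(r)² + (a(r)² − 1)²/r²) + C₁ r² f'(r)² + 2κ a(r)² sin² f(r) (2 f'(r)² + a(r)² sin² f(r)/r²) + C₂ a(r)² f(r)² } dr. -/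

import Mathlib

open Real MeasureTheory Set Filter

noncomputable section

/-- `h` is continuous on `[0,∞)` and absolutely continuous on every compact
subinterval of `(0,∞)` (encoded via the fundamental theorem of calculus,
with `deriv h` playing the role of the a.e. derivative `h'`). -/
def LocAC (h : ℝ → ℝ) : Prop :=
  ContinuousOn h (Set.Ici 0) ∧
  ∀ s t : ℝ, 0 < s → s ≤ t →
    IntervalIntegrable (deriv h) MeasureTheory.volume s t ∧
    h t - h s = ∫ r in s..t, deriv h r

/-- `h` is locally absolutely continuous on `(0,∞)`, with derivative `deriv h`. -/
def LocACIoi (h : ℝ → ℝ) : Prop :=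
  ∀ s t : ℝ, 0 < s → s ≤ t →
    IntervalIntegrable (deriv h) MeasureTheory.volume s t ∧
    h t - h s = ∫ r in s..t, deriv h r

/-- The density `𝓔₁`. -/
def calE1 (κ : ℝ) (a f : ℝ → ℝ) (r : ℝ) : ℝ :=
  2 * (2 * (deriv a r) ^ 2 + ((a r) ^ 2 - 1) ^ 2 / r ^ 2)
    + (1 / 2) * (r ^ 2 * (deriv f r) ^ 2 + 2 * (a r) ^ 2 * Real.sin (f r) ^ 2)
    + 2 * κ * (a r) ^ 2 * Real.sin (f r) ^ 2
        * (2 * (deriv f r) ^ 2 + (a r) ^ 2 * Real.sin (f r) ^ 2 / r ^ 2)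

/-- The density `𝓔₂`. -/
def calE2 (a g : ℝ → ℝ) (r : ℝ) : ℝ :=
  r ^ 2 * (deriv g r) ^ 2 + 2 * (a r) ^ 2 * (g r) ^ 2

/-- Finite energy: `E(a,f,g) = ∫₀^∞ (𝓔₁ + 𝓔₂) dr < ∞`. -/
def FiniteEnergy (κ : ℝ) (a f g : ℝ → ℝ) : Prop :=
  MeasureTheory.IntegrableOn (fun r => calE1 κ a f r + calE2 a g r) (Set.Ioi 0)

/-- The action `L(a,f,g) = ∫₀^∞ (𝓔₁ - 𝓔₂) dr`. -/
def actionL (κ : ℝ) (a f g : ℝ → ℝ) : ℝ :=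
  ∫ r in Set.Ioi (0 : ℝ), (calE1 κ a f r - calE2 a g r)

/-- The admissible class `𝒜`. -/
structure Admissible (κ ω q : ℝ) (a f g : ℝ → ℝ) : Prop where
  locAC_a : LocAC a
  locAC_f : LocAC f
  locAC_g : LocAC g
  a_zero : a 0 = 1
  f_zero : f 0 = 0
  a_infty : Filter.Tendsto a Filter.atTop (nhds 0)
  f_infty : Filter.Tendsto f Filter.atTop (nhds (Real.pi - ω))
  g_infty : Filter.Tendsto g Filter.atTop (nhds q)
  finite_energy : FiniteEnergy κ a f g

/-- The constrained class `𝒞`: members of `𝒜` such that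
`∫₀^∞ (r² g' G' + 2 a² g G) dr = 0` for every admissible test function `G`. -/
def Constrained (κ ω q : ℝ) (a f g : ℝ → ℝ) : Prop :=
  Admissible κ ω q a f g ∧
  ∀ G : ℝ → ℝ, LocACIoi G → Filter.Tendsto G Filter.atTop (nhds 0) →
    MeasureTheory.IntegrableOn
      (fun r => r ^ 2 * (deriv G r) ^ 2 + 2 * (a r) ^ 2 * (G r) ^ 2) (Set.Ioi 0) →
    MeasureTheory.IntegrableOn
      (fun r => r ^ 2 * deriv g r * deriv G r + 2 * (a r) ^ 2 * g r * G r) (Set.Ioi 0) ∧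
    ∫ r in Set.Ioi (0 : ℝ), (r ^ 2 * deriv g r * deriv G r + 2 * (a r) ^ 2 * g r * G r) = 0

/-- The functional `E₂(a,G) = ∫₀^∞ (r² G'² + 2 a² G²) dr`, valued in `[0,∞]`. -/
def E2lint (a G : ℝ → ℝ) : ENNReal :=
  ∫⁻ r in Set.Ioi (0 : ℝ),
    ENNReal.ofReal (r ^ 2 * (deriv G r) ^ 2 + 2 * (a r) ^ 2 * (G r) ^ 2)

lemma LocAC.const_mul_locACIoi {h : ℝ → ℝ} (hh : LocAC h) (c : ℝ) :
    LocACIoi (fun r => c * h r) := by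
  intro s t hs hst
  obtain ⟨hi, he⟩ := hh.2 s t hs hst
  rw [show deriv (fun r => c * h r) = fun r => c * deriv h r from
    funext fun r => deriv_const_mul_field c]
  refine ⟨hi.const_mul c, ?_⟩
  rw [intervalIntegral.integral_const_mul, ← he]
  ring

lemma LocAC.aemeasurable {h : ℝ → ℝ} (hh : LocAC h) :
    AEMeasurable h (volume.restrict (Ioi 0)) :=
  (hh.1.mono Ioi_subset_Ici_self).aemeasurable measurableSet_Ioi

/-- The density on the right-hand side of the coercive bound. -/
def coerciveDensity (κ C₁ C₂ : ℝ) (a f : ℝ → ℝ) (r : ℝ) : ℝ :=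
  2 * (2 * (deriv a r) ^ 2 + ((a r) ^ 2 - 1) ^ 2 / r ^ 2)
    + C₁ * r ^ 2 * (deriv f r) ^ 2
    + 2 * κ * (a r) ^ 2 * Real.sin (f r) ^ 2
        * (2 * (deriv f r) ^ 2 + (a r) ^ 2 * Real.sin (f r) ^ 2 / r ^ 2)
    + C₂ * (a r) ^ 2 * (f r) ^ 2

lemma coerciveDensity_nonneg {κ C₁ C₂ : ℝ} (hκ : 0 ≤ κ) (h₁ : 0 ≤ C₁) (h₂ : 0 ≤ C₂)
    (a f : ℝ → ℝ) (r : ℝ) : 0 ≤ coerciveDensity κ C₁ C₂ a f r := by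
  unfold coerciveDensity
  positivity

lemma calE1_nonneg {κ : ℝ} (hκ : 0 ≤ κ) (a f : ℝ → ℝ) (r : ℝ) : 0 ≤ calE1 κ a f r := by
  unfold calE1
  positivity

lemma calE2_nonneg (a g : ℝ → ℝ) (r : ℝ) : 0 ≤ calE2 a g r := by
  unfold calE2
  positivity

lemma calE2_const_mul (a f : ℝ → ℝ) (c r : ℝ) :
    calE2 a (fun r => c * f r) r = c ^ 2 * calE2 a f r := by
  simp only [calE2, deriv_const_mul_field]
  ring

/-- Jordan's inequality turns the `sin²` potential in `𝓔₁` into a quadratic one. -/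
lemma coerciveDensity_add_le_calE1 {κ c : ℝ} {a f : ℝ → ℝ} {r : ℝ}
    (hf₀ : 0 ≤ f r) (hf₁ : f r ≤ π / 2) :
    coerciveDensity κ (1 / 2 - c ^ 2) (4 / π ^ 2 - 2 * c ^ 2) a f r
      + calE2 a (fun r => c * f r) r ≤ calE1 κ a f r := by
  have hsin : 4 / π ^ 2 * f r ^ 2 ≤ sin (f r) ^ 2 := by
    calc 4 / π ^ 2 * f r ^ 2 = (2 / π * f r) ^ 2 := by ring
      _ ≤ sin (f r) ^ 2 := pow_le_pow_left₀ (by positivity) (mul_le_sin hf₀ hf₁) 2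
  have := mul_le_mul_of_nonneg_left hsin (sq_nonneg (a r))
  rw [calE2_const_mul]
  unfold coerciveDensity calE1 calE2
  linarith

lemma integral_calE2_le_of_E2lint_le {a g G : ℝ → ℝ}
    (hg : IntegrableOn (calE2 a g) (Ioi 0)) (hG : IntegrableOn (calE2 a G) (Ioi 0))
    (h : E2lint a g ≤ E2lint a G) :
    ∫ r in Ioi 0, calE2 a g r ≤ ∫ r in Ioi 0, calE2 a G r := by
  refine (ENNReal.ofReal_le_ofReal_iff (integral_nonneg fun r => calE2_nonneg a G r)).1 ?_
  rw [ofReal_integral_eq_lintegral_ofReal hg (ae_of_all _ fun r => calE2_nonneg a g r),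
    ofReal_integral_eq_lintegral_ofReal hG (ae_of_all _ fun r => calE2_nonneg a G r)]
  exact h

/-- the partial coercive lower bound for the action `L` on `𝒞`. -/
theorem coercive_lower_bound
    (κ ω q qw C₁ C₂ : ℝ) (hκ : 0 < κ) (hω : ω ∈ Set.Ioo (Real.pi / 2) Real.pi)
    (hqw : qw = (Real.sqrt 2 / Real.pi) * (Real.pi - ω))
    (hq0 : 0 < q) (hq1 : q < qw)
    (hC₁ : C₁ = 1 / 2 - q ^ 2 / (Real.pi - ω) ^ 2)
    (hC₂ : C₂ = 2 * (qw ^ 2 - q ^ 2) / (Real.pi - ω) ^ 2)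
    (a f g : ℝ → ℝ) (hafg : Constrained κ ω q a f g)
    (hf : ∀ r ∈ Set.Ici (0 : ℝ), 0 ≤ f r ∧ f r ≤ Real.pi / 2)
    (hgmin : ∀ G : ℝ → ℝ, LocACIoi G → Filter.Tendsto G Filter.atTop (nhds q) →
      E2lint a g ≤ E2lint a G) :
    0 < C₁ ∧ 0 < C₂ ∧
    MeasureTheory.IntegrableOn
      (fun r => 2 * (2 * (deriv a r) ^ 2 + ((a r) ^ 2 - 1) ^ 2 / r ^ 2)
        + C₁ * r ^ 2 * (deriv f r) ^ 2
        + 2 * κ * (a r) ^ 2 * Real.sin (f r) ^ 2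
            * (2 * (deriv f r) ^ 2 + (a r) ^ 2 * Real.sin (f r) ^ 2 / r ^ 2)
        + C₂ * (a r) ^ 2 * (f r) ^ 2) (Set.Ioi 0) ∧
    (∫ r in Set.Ioi (0 : ℝ),
        (2 * (2 * (deriv a r) ^ 2 + ((a r) ^ 2 - 1) ^ 2 / r ^ 2)
          + C₁ * r ^ 2 * (deriv f r) ^ 2
          + 2 * κ * (a r) ^ 2 * Real.sin (f r) ^ 2
              * (2 * (deriv f r) ^ 2 + (a r) ^ 2 * Real.sin (f r) ^ 2 / r ^ 2)
          + C₂ * (a r) ^ 2 * (f r) ^ 2))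
      ≤ actionL κ a f g := by
  have hπ := Real.pi_pos
  have hd : 0 < π - ω := sub_pos.2 hω.2
  obtain ⟨hA, -⟩ := hafg
  set c := q / (π - ω) with hc
  have hqc : q = c * (π - ω) := by rw [hc]; field_simp
  have hC₁' : C₁ = 1 / 2 - c ^ 2 := by rw [hC₁, hc, div_pow]
  have hqw2 : qw ^ 2 = 2 / π ^ 2 * (π - ω) ^ 2 := by
    rw [hqw, mul_pow, div_pow, Real.sq_sqrt (by norm_num)]
  have hC₂' : C₂ = 4 / π ^ 2 - 2 * c ^ 2 := by
    rw [hC₂, hqw2, hqc]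
    field_simp
    ring
  have hC₂pos : 0 < C₂ := by
    have : q ^ 2 < qw ^ 2 := pow_lt_pow_left₀ hq1 hq0.le two_ne_zero
    rw [hC₂]
    exact div_pos (by linarith) (by positivity)
  have hC₁pos : 0 < C₁ := by
    have : 4 / π ^ 2 ≤ 1 := by
      rw [div_le_one (by positivity)]
      nlinarith [Real.two_le_pi]
    linarith
  have ma := hA.locAC_a.aemeasurable
  have mf := hA.locAC_f.aemeasurable
  have mg := hA.locAC_g.aemeasurable
  have ma' := measurable_deriv a
  have mf' := measurable_deriv f
  have mg' := measurable_deriv g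
  have hE1 : IntegrableOn (calE1 κ a f) (Ioi 0) := by
    refine hA.finite_energy.mono' ?_ (ae_of_all _ fun r => ?_)
    · apply AEMeasurable.aestronglyMeasurable
      unfold calE1
      fun_prop
    · rw [Real.norm_of_nonneg (calE1_nonneg hκ.le a f r)]
      linarith [calE2_nonneg a g r]
  have hE2 : IntegrableOn (calE2 a g) (Ioi 0) := by
    refine hA.finite_energy.mono' ?_ (ae_of_all _ fun r => ?_)
    · apply AEMeasurable.aestronglyMeasurable
      unfold calE2
      fun_prop
    · rw [Real.norm_of_nonneg (calE2_nonneg a g r)]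
      linarith [calE1_nonneg hκ.le a f r]
  have hDnn := coerciveDensity_nonneg hκ.le hC₁pos.le hC₂pos.le a f
  have hle : ∀ r ∈ Ioi (0 : ℝ),
      coerciveDensity κ C₁ C₂ a f r + calE2 a (fun r => c * f r) r ≤ calE1 κ a f r := by
    intro r hr
    have := hf r (Ioi_subset_Ici_self hr)
    rw [hC₁', hC₂']
    exact coerciveDensity_add_le_calE1 this.1 this.2
  have hD : IntegrableOn (coerciveDensity κ C₁ C₂ a f) (Ioi 0) := by
    refine hE1.mono' ?_ (ae_restrict_of_forall_mem measurableSet_Ioi fun r hr => ?_)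
    · apply AEMeasurable.aestronglyMeasurable
      unfold coerciveDensity
      fun_prop
    · rw [Real.norm_of_nonneg (hDnn r)]
      linarith [hle r hr, calE2_nonneg a (fun r => c * f r) r]
  have hG : IntegrableOn (calE2 a fun r => c * f r) (Ioi 0) := by
    refine hE1.mono' ?_ (ae_restrict_of_forall_mem measurableSet_Ioi fun r hr => ?_)
    · apply AEMeasurable.aestronglyMeasurable
      simp only [funext (calE2_const_mul a f c), calE2]
      fun_prop
    · rw [Real.norm_of_nonneg (calE2_nonneg a _ r)]
      linarith [hle r hr, hDnn r]
  refine ⟨hC₁pos, hC₂pos, hD, ?_⟩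
  change ∫ r in Ioi 0, coerciveDensity κ C₁ C₂ a f r ≤ _
  have hgG := integral_calE2_le_of_E2lint_le hE2 hG
    (hgmin _ (hA.locAC_f.const_mul_locACIoi c) (hqc ▸ hA.f_infty.const_mul c))
  have hmono := setIntegral_mono_on (hD.add hG) hE1 measurableSet_Ioi hle
  rw [integral_add' hD hG] at hmono
  rw [actionL, integral_sub hE1 hE2]
  linarith
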